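/- Let μ be an ℝ^n-valued Borel measure on ℝ^n of finite total variation with finite first moments such that ∫⟨u, dμ⟩ ≥ 0 for every monotone map u ∈ C¹(ℝ^n, ℝ^n). Then there exists a Borel measure M on ℝ^n with values in the symmetric positive semidefinite n×n matrices such that μ = −div M and ∫ tr(dM) = ∫⟨x, dμ(x)⟩. Conversely, if M is a measure with values in symmetric positive semidefinite n×n matrices and −div M is a finite vector-valued measure μ, then ∫⟨u, dμ⟩ ≥ 0 for every monotone u ∈ C¹(ℝ^n, ℝ^n). -/

import Mathlib

open Matrix MeasureTheory Filter
open scoped RealInnerProductSpace Topology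

noncomputable section

/-- Real power of a square real matrix via spectral decomposition (junk value `0`
for non-Hermitian matrices). -/
def matPow {n : ℕ} (A : Matrix (Fin n) (Fin n) ℝ) (r : ℝ) : Matrix (Fin n) (Fin n) ℝ :=
  if hA : A.IsHermitian then
    (hA.eigenvectorUnitary : Matrix (Fin n) (Fin n) ℝ) *
      Matrix.diagonal (fun i => (hA.eigenvalues i) ^ r) *
      (star hA.eigenvectorUnitary : Matrix.unitaryGroup (Fin n) ℝ)
  else 0

/-- Absolute value `|A| = (A^* A)^{1/2}` of a real rectangular matrix. -/
def matAbs {m n : ℕ} (A : Matrix (Fin m) (Fin n) ℝ) : Matrix (Fin n) (Fin n) ℝ :=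
  matPow (Aᴴ * A) (1/2)

/-- Euclidean space ℝⁿ. -/
abbrev Euc (n : ℕ) := EuclideanSpace ℝ (Fin n)

/-- Frobenius (trace) pairing ⟨A, B⟩ = tr(AB^*) of two m×n matrices. -/
def frob {m n : ℕ} (A B : Matrix (Fin m) (Fin n) ℝ) : ℝ := Matrix.trace (A * Bᴴ)

/-- The matrix of the Fréchet derivative of f : ℝⁿ → ℝᵐ at x. -/
def fderivMat {n m : ℕ} (f : Euc n → Euc m) (x : Euc n) : Matrix (Fin m) (Fin n) ℝ :=
  Matrix.of fun i j => fderiv ℝ f x (EuclideanSpace.single j 1) i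

/-- f ∈ C¹(ℝⁿ, ℝᵐ): continuously differentiable with bounded derivative. -/
def C1b {n m : ℕ} (f : Euc n → Euc m) : Prop :=
  ContDiff ℝ 1 f ∧ ∃ C : ℝ, ∀ x, ‖fderiv ℝ f x‖ ≤ C

/-- f ∈ C¹₀(ℝⁿ, ℝᵐ): continuously differentiable with derivative vanishing at
infinity. -/
def C1z {n m : ℕ} (f : Euc n → Euc m) : Prop :=
  ContDiff ℝ 1 f ∧ Tendsto (fun x => ‖fderiv ℝ f x‖) (cocompact (Euc n)) (nhds 0)

/-- The C¹ seminorm ‖f‖_{C¹} = sup_x ‖Df(x)‖ (operator norm). -/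
def C1Norm {n m : ℕ} (f : Euc n → Euc m) : ℝ := ⨆ x, ‖fderiv ℝ f x‖

/-- An ℝᵐ-valued Borel measure μ on ℝⁿ of finite total variation, encoded by its
total variation measure `var = ‖μ‖` together with its polar (Radon–Nikodym)
density `density = dμ/d‖μ‖`, a vector field of norm one ‖μ‖-a.e.; thus
μ(E) = ∫_E density d‖μ‖. -/
structure VecMeas (n m : ℕ) where
  var : Measure (Euc n)
  density : Euc n → Euc m
  finite : IsFiniteMeasure var
  measurable_density : Measurable density
  norm_density : ∀ᵐ x ∂var, ‖density x‖ = 1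

/-- The pairing ∫ ⟨f, dμ⟩. -/
def VecMeas.pair {n m : ℕ} (μ : VecMeas n m) (f : Euc n → Euc m) : ℝ :=
  ∫ x, ⟪f x, μ.density x⟫ ∂μ.var

/-- μ(ℝⁿ) = 0. -/
def VecMeas.totalZero {n m : ℕ} (μ : VecMeas n m) : Prop :=
  ∫ x, μ.density x ∂μ.var = 0

/-- Finite first moments: ∫ ‖x‖ d‖μ‖(x) < ∞. -/
def VecMeas.finiteFirstMoment {n m : ℕ} (μ : VecMeas n m) : Prop :=
  Integrable (fun x => ‖x‖) μ.var

/-- An ℝ^{m×n}-valued Borel measure M on ℝⁿ of finite total variation with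
respect to the Schatten 1-norm, encoded by its total variation measure
`var = ‖M‖₁` together with its Radon–Nikodym density `density = dM/d‖M‖₁`,
a matrix field of Schatten 1-norm one ‖M‖₁-a.e. -/
structure MatMeas (n m : ℕ) where
  var : Measure (Euc n)
  density : Euc n → Matrix (Fin m) (Fin n) ℝ
  finite : IsFiniteMeasure var
  measurable_density : ∀ i j, Measurable fun x => density x i j
  norm_density : ∀ᵐ x ∂var, Matrix.trace (matAbs (density x)) = 1

/-- The total variation norm ‖M‖_𝓜 = ‖M‖₁(ℝⁿ). -/
def MatMeas.tvNorm {n m : ℕ} (M : MatMeas n m) : ℝ := (M.var Set.univ).toReal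

/-- The pairing ∫ ⟨G, dM⟩ of a matrix field G against M. -/
def MatMeas.pair {n m : ℕ} (M : MatMeas n m) (G : Euc n → Matrix (Fin m) (Fin n) ℝ) : ℝ :=
  ∫ x, frob (G x) (M.density x) ∂M.var

/-- −div M = μ: for all f ∈ C¹₀(ℝⁿ, ℝᵐ), ∫⟨f, dμ⟩ = ∫⟨Df, dM⟩. -/
def IsNegDiv {n m : ℕ} (M : MatMeas n m) (μ : VecMeas n m) : Prop :=
  ∀ f : Euc n → Euc m, C1z f → μ.pair f = M.pair (fderivMat f)

/-- J(μ) = sup { ∫⟨u, dμ⟩ : u ∈ C¹(ℝⁿ,ℝᵐ), ‖u‖_{C¹} ≤ 1 }. -/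
def Jsup {n m : ℕ} (μ : VecMeas n m) : ℝ :=
  sSup {r | ∃ f : Euc n → Euc m, C1b f ∧ C1Norm f ≤ 1 ∧ r = μ.pair f}

/-- I(μ) = inf { ‖M‖_𝓜 : −div M = μ }. -/
def Iinf {n m : ℕ} (μ : VecMeas n m) : ℝ :=
  sInf {r | ∃ M : MatMeas n m, IsNegDiv M μ ∧ r = M.tvNorm}

/-- u : ℝⁿ → ℝⁿ is monotone: ⟨u(x) − u(y), x − y⟩ ≥ 0 for all x, y. -/
def IsMonotoneMap {n : ℕ} (u : Euc n → Euc n) : Prop :=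
  ∀ x y, 0 ≤ ⟪u x - u y, x - y⟫


open scoped BoundedContinuousFunction CompactlySupported

/-- For positive semidefinite `A`, `|A| = A`. -/
lemma matAbs_of_posSemidef {n : ℕ} {A : Matrix (Fin n) (Fin n) ℝ} (hA : A.PosSemidef) :
    matAbs A = A := by
  have hH : A.IsHermitian := hA.1
  have hB : (Aᴴ * A).IsHermitian := Matrix.isHermitian_conjTranspose_mul_self A
  have h1 : matAbs A = cfc (fun x : ℝ => x ^ (1/2 : ℝ)) (Aᴴ * A) := by
    rw [matAbs, matPow, dif_pos hB, hB.cfc_eq, Matrix.IsHermitian.cfc,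
      Unitary.conjStarAlgAut_apply]
    rfl
  have h2 : Aᴴ * A = cfc (fun x : ℝ => x ^ 2) A := by
    rw [cfc_pow_id A 2 hH.isSelfAdjoint, hH.eq, sq]
  have hfin : ∀ (B : Matrix (Fin n) (Fin n) ℝ) (f : ℝ → ℝ), ContinuousOn f (spectrum ℝ B) := by
    intro B f
    exact (Matrix.finite_real_spectrum (A := B)).continuousOn f
  rw [h1, h2, ← cfc_comp' (fun x : ℝ => x ^ (1/2 : ℝ)) (fun x : ℝ => x ^ 2) A
    ((((Matrix.finite_real_spectrum (A := A)).image _)).continuousOn _) (hfin _ _) hH.isSelfAdjoint]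
  conv_rhs => rw [← cfc_id' ℝ A hH.isSelfAdjoint]
  apply cfc_congr
  intro x hx
  have hx0 : 0 ≤ x := by
    obtain ⟨i, rfl⟩ := hH.spectrum_real_eq_range_eigenvalues ▸ hx
    exact hA.eigenvalues_nonneg i
  show (x ^ 2) ^ (1/2 : ℝ) = x
  rw [← Real.sqrt_eq_rpow, Real.sqrt_sq hx0]

lemma monotone_of_fderiv {n : ℕ} {u : Euc n → Euc n} (hu : Differentiable ℝ u)
    (h : ∀ x v, 0 ≤ ⟪fderiv ℝ u x v, v⟫) : IsMonotoneMap u := by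
  intro x y
  have hd : ∀ t : ℝ, HasDerivAt (fun t : ℝ => ⟪u (y + t • (x - y)), x - y⟫)
      ⟪fderiv ℝ u (y + t • (x - y)) (x - y), x - y⟫ t := by
    intro t
    have h1 : HasDerivAt (fun t : ℝ => y + t • (x - y)) (x - y) t := by
      simpa using ((hasDerivAt_id t).smul_const (x - y)).const_add y
    have h2 := (hu (y + t • (x - y))).hasFDerivAt.comp_hasDerivAt t h1
    simpa using h2.inner ℝ (hasDerivAt_const t (x - y))
  have hm : Monotone (fun t : ℝ => ⟪u (y + t • (x - y)), x - y⟫) :=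
    monotone_of_deriv_nonneg (fun t => (hd t).differentiableAt) (fun t => by
      rw [(hd t).deriv]; exact h _ _)
  have := hm (zero_le_one)
  simp only [zero_smul, add_zero, one_smul, add_sub_cancel] at this
  rw [inner_sub_left]; linarith

lemma fderiv_of_monotone {n : ℕ} {u : Euc n → Euc n} (hu : Differentiable ℝ u)
    (h : IsMonotoneMap u) (x v : Euc n) : 0 ≤ ⟪fderiv ℝ u x v, v⟫ := by
  have hd : HasDerivAt (fun t : ℝ => ⟪u (x + t • v), v⟫) ⟪fderiv ℝ u x v, v⟫ 0 := by
    have h1 : HasDerivAt (fun t : ℝ => x + t • v) v 0 := by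
      simpa using ((hasDerivAt_id (0:ℝ)).smul_const v).const_add x
    have h3 : HasFDerivAt u (fderiv ℝ u x) (x + (0:ℝ) • v) := by
      simpa using (hu x).hasFDerivAt
    have h2 := h3.comp_hasDerivAt (0:ℝ) h1
    simpa using h2.inner ℝ (hasDerivAt_const (0:ℝ) v)
  have hm : Monotone (fun t : ℝ => ⟪u (x + t • v), v⟫) := by
    intro s t hst
    rcases hst.eq_or_lt with rfl | hlt
    · exact le_rfl
    have := h (x + t • v) (x + s • v)
    have e : x + t • v - (x + s • v) = (t - s) • v := by module
    rw [e, inner_smul_right, inner_sub_left] at this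
    have hp : 0 < t - s := by linarith
    have := nonneg_of_mul_nonneg_right this hp
    simpa using this
  rw [← hd.deriv]
  exact hm.deriv_nonneg

lemma C1b.growth {n m : ℕ} {f : Euc n → Euc m} (hf : C1b f) :
    ∃ C : ℝ, 0 ≤ C ∧ ∀ x, ‖f x‖ ≤ C * (1 + ‖x‖) := by
  obtain ⟨hc, C, hC⟩ := hf
  have hC0 : 0 ≤ C := (norm_nonneg _).trans (hC 0)
  refine ⟨C + ‖f 0‖, by positivity, fun x => ?_⟩
  have h := Convex.norm_image_sub_le_of_norm_fderiv_le (𝕜 := ℝ) (f := f) (C := C) (s := Set.univ)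
    (x := 0) (y := x) (fun y _ => (hc.differentiable one_ne_zero) y) (fun y _ => hC y) convex_univ
    trivial trivial
  have h2 : ‖f x‖ ≤ ‖f x - f 0‖ + ‖f 0‖ := by
    simpa using norm_add_le (f x - f 0) (f 0)
  rw [sub_zero] at h
  nlinarith [norm_nonneg x, norm_nonneg (f 0), mul_nonneg (norm_nonneg x) (norm_nonneg (f 0))]

lemma C1b.integrable {n m : ℕ} {f : Euc n → Euc m} (hf : C1b f) (μ : VecMeas n m)
    (hμ : μ.finiteFirstMoment) : Integrable (fun x => ⟪f x, μ.density x⟫) μ.var := by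
  have := μ.finite
  obtain ⟨C, hC0, hC⟩ := hf.growth
  have hb : Integrable (fun x : Euc n => C * (1 + ‖x‖)) μ.var :=
    ((integrable_const 1).add hμ).const_mul C
  refine hb.mono' ?_ ?_
  · exact (hf.1.continuous.measurable.inner μ.measurable_density).aestronglyMeasurable
  · filter_upwards [μ.norm_density] with x hx
    calc ‖⟪f x, μ.density x⟫‖ ≤ ‖f x‖ * ‖μ.density x‖ := norm_inner_le_norm _ _
      _ ≤ _ := by rw [hx, mul_one]; exact hC x

lemma C1b.add {n m : ℕ} {f g : Euc n → Euc m} (hf : C1b f) (hg : C1b g) :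
    C1b (fun x => f x + g x) := by
  obtain ⟨hc, C, hC⟩ := hf
  obtain ⟨hc', C', hC'⟩ := hg
  refine ⟨hc.add hc', C + C', fun x => ?_⟩
  rw [fderiv_fun_add (hc.differentiable one_ne_zero x) (hc'.differentiable one_ne_zero x)]
  exact (norm_add_le _ _).trans (add_le_add (hC x) (hC' x))

lemma C1b.smul {n m : ℕ} {f : Euc n → Euc m} (hf : C1b f) (c : ℝ) :
    C1b (fun x => c • f x) := by
  obtain ⟨hc, C, hC⟩ := hf
  refine ⟨hc.const_smul c, ‖c‖ * C, fun x => ?_⟩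
  rw [fderiv_fun_const_smul (hc.differentiable one_ne_zero x), norm_smul]
  exact mul_le_mul_of_nonneg_left (hC x) (norm_nonneg _)

lemma C1b.const {n m : ℕ} (c : Euc m) : C1b (fun _ : Euc n => c) :=
  ⟨contDiff_const, 0, fun x => by simp⟩

lemma C1b.id' {n : ℕ} : C1b (fun x : Euc n => x) :=
  ⟨contDiff_id, 1, fun x => by
    rw [fderiv_fun_id]; exact ContinuousLinearMap.norm_id_le⟩

lemma C1z.c1b {n m : ℕ} {f : Euc n → Euc m} (hf : C1z f) : C1b f := by
  refine ⟨hf.1, ?_⟩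
  have hc : Continuous (fun x => fderiv ℝ f x) := hf.1.continuous_fderiv one_ne_zero
  have h1 : ∀ᶠ x in cocompact (Euc n), ‖fderiv ℝ f x‖ < 1 := hf.2.eventually_lt_const one_pos
  obtain ⟨K, hK, hK'⟩ := mem_cocompact.1 h1
  obtain ⟨C, hC⟩ := hK.exists_bound_of_continuousOn hc.continuousOn
  refine ⟨max C 1, fun x => ?_⟩
  by_cases hx : x ∈ K
  · exact (hC x hx).trans (le_max_left _ _)
  · exact (le_of_lt (hK' hx)).trans (le_max_right _ _)

lemma VecMeas.pair_add {n m : ℕ} (μ : VecMeas n m) (hμ : μ.finiteFirstMoment)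
    {f g : Euc n → Euc m} (hf : C1b f) (hg : C1b g) :
    μ.pair (fun x => f x + g x) = μ.pair f + μ.pair g := by
  simp only [VecMeas.pair, inner_add_left]
  exact integral_add (hf.integrable μ hμ) (hg.integrable μ hμ)

lemma VecMeas.pair_smul {n m : ℕ} (μ : VecMeas n m) (f : Euc n → Euc m) (c : ℝ) :
    μ.pair (fun x => c • f x) = c * μ.pair f := by
  simp only [VecMeas.pair, real_inner_smul_left]
  exact integral_const_mul _ _

/-- The M. Riesz extension step. -/
lemma exists_positive_functional {n : ℕ} (μ : VecMeas n n) (hμ : μ.finiteFirstMoment)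
    (hpos : ∀ u : Euc n → Euc n, C1b u → IsMonotoneMap u → 0 ≤ μ.pair u) :
    ∃ g : (Euc n →ᵇ (Euc n →L[ℝ] Euc n)) →ₗ[ℝ] ℝ,
      (∀ f : Euc n → Euc n, C1b f → ∀ G : Euc n →ᵇ (Euc n →L[ℝ] Euc n),
        (∀ x, G x = fderiv ℝ f x) → g G = μ.pair f) ∧
      ∀ G : Euc n →ᵇ (Euc n →L[ℝ] Euc n), (∀ x v, 0 ≤ ⟪G x v, v⟫) → 0 ≤ g G := by
  have hle : ∀ f g : Euc n → Euc n, C1b f → C1b g → (∀ x, fderiv ℝ f x = fderiv ℝ g x) →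
      μ.pair f ≤ μ.pair g := by
    intro f g hf hg h
    have h0 : C1b (fun x => g x + (-1:ℝ) • f x) := hg.add (hf.smul _)
    have h1 := hpos _ h0 (monotone_of_fderiv (h0.1.differentiable one_ne_zero) (fun x v => by
      rw [fderiv_fun_add (hg.1.differentiable one_ne_zero x)
        ((hf.smul _).1.differentiable one_ne_zero x),
        fderiv_fun_const_smul (hf.1.differentiable one_ne_zero x), h x]
      simp))
    rw [μ.pair_add hμ hg (hf.smul _), μ.pair_smul] at h1
    linarith
  have heq : ∀ f g : Euc n → Euc n, C1b f → C1b g → (∀ x, fderiv ℝ f x = fderiv ℝ g x) →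
      μ.pair f = μ.pair g := fun f g hf hg h =>
    le_antisymm (hle f g hf hg h) (hle g f hg hf fun x => (h x).symm)
  let V : Submodule ℝ (Euc n →ᵇ (Euc n →L[ℝ] Euc n)) :=
    { carrier := {G | ∃ f : Euc n → Euc n, C1b f ∧ ∀ x, G x = fderiv ℝ f x}
      add_mem' := by
        rintro G H ⟨f, hf, hG⟩ ⟨g, hg, hH⟩
        refine ⟨fun x => f x + g x, hf.add hg, fun x => ?_⟩
        rw [fderiv_fun_add (hf.1.differentiable one_ne_zero x)
          (hg.1.differentiable one_ne_zero x), ← hG, ← hH]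
        rfl
      zero_mem' := ⟨fun _ => 0, C1b.const 0, fun x => by simp⟩
      smul_mem' := by
        rintro c G ⟨f, hf, hG⟩
        refine ⟨fun x => c • f x, hf.smul c, fun x => ?_⟩
        rw [fderiv_fun_const_smul (hf.1.differentiable one_ne_zero x), ← hG]
        rfl }
  have hV : ∀ G : V, ∃ f : Euc n → Euc n, C1b f ∧ ∀ x, G.1 x = fderiv ℝ f x := fun G => G.2
  choose F hF hFG using hV
  let L : V →ₗ[ℝ] ℝ :=
    { toFun := fun G => μ.pair (F G)
      map_add' := by
        intro G H
        rw [← μ.pair_add hμ (hF G) (hF H)]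
        refine heq _ _ (hF _) ((hF G).add (hF H)) fun x => ?_
        rw [fderiv_fun_add ((hF G).1.differentiable one_ne_zero x)
          ((hF H).1.differentiable one_ne_zero x), ← hFG, ← hFG, ← hFG]
        rfl
      map_smul' := by
        intro c G
        simp only [RingHom.id_apply, smul_eq_mul]
        rw [← μ.pair_smul]
        refine heq _ _ (hF _) ((hF G).smul c) fun x => ?_
        rw [fderiv_fun_const_smul ((hF G).1.differentiable one_ne_zero x), ← hFG, ← hFG]
        rfl }
  let s : PointedCone ℝ (Euc n →ᵇ (Euc n →L[ℝ] Euc n)) :=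
    { carrier := {G | ∀ x v, 0 ≤ ⟪G x v, v⟫}
      add_mem' := by
        intro G H hG hH x v
        have := add_nonneg (hG x v) (hH x v)
        simpa [inner_add_left] using this
      zero_mem' := by intro x v; simp
      smul_mem' := by
        rintro c G hG x v
        have := mul_nonneg c.2 (hG x v)
        have e : ((c • G) x) v = (c : ℝ) • (G x v) := rfl
        rw [e, real_inner_smul_left]
        exact this }
  have hnn : ∀ G : V, (G : Euc n →ᵇ (Euc n →L[ℝ] Euc n)) ∈ s → 0 ≤ L G := by
    intro G hG
    refine hpos _ (hF G) (monotone_of_fderiv ((hF G).1.differentiable one_ne_zero) ?_)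
    intro x v
    rw [← hFG]
    exact hG x v
  have hdense : ∀ G : Euc n →ᵇ (Euc n →L[ℝ] Euc n), ∃ H : V,
      (H : Euc n →ᵇ (Euc n →L[ℝ] Euc n)) + G ∈ s := by
    intro G
    refine ⟨⟨BoundedContinuousFunction.const _ (‖G‖ • ContinuousLinearMap.id ℝ (Euc n)),
      ?_⟩, ?_⟩
    · refine ⟨fun x => ‖G‖ • x, C1b.id'.smul _, fun x => ?_⟩
      rw [fderiv_fun_const_smul differentiableAt_fun_id, fderiv_fun_id]
      rfl
    · intro x v
      have e : ((BoundedContinuousFunction.const (Euc n) (‖G‖ • ContinuousLinearMap.id ℝ (Euc n))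
        + G) x) v = ‖G‖ • v + G x v := rfl
      show 0 ≤ ⟪((BoundedContinuousFunction.const (Euc n) (‖G‖ • ContinuousLinearMap.id ℝ (Euc n))
        + G) x) v, v⟫
      rw [e, inner_add_left, real_inner_smul_left, real_inner_self_eq_norm_sq]
      have h1 : |⟪G x v, v⟫| ≤ ‖G x v‖ * ‖v‖ := abs_real_inner_le_norm _ _
      have h2 : ‖G x v‖ ≤ ‖G‖ * ‖v‖ := (G x).le_of_opNorm_le (G.norm_coe_le_norm x) v
      have h3 := neg_abs_le ⟪G x v, v⟫
      nlinarith [norm_nonneg v]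
  obtain ⟨g, hg1, hg2⟩ := riesz_extension (E := Euc n →ᵇ (Euc n →L[ℝ] Euc n)) s
    (LinearPMap.mk V L) hnn hdense
  refine ⟨g, ?_, hg2⟩
  intro f hf G hG
  have := hg1 ⟨G, f, hf, hG⟩
  refine this.trans ?_
  exact heq _ _ (hF _) hf fun x => by rw [← hFG, ← hG]

/-- The matrix of a continuous linear endomorphism. -/
def clmMat {n : ℕ} (T : Euc n →L[ℝ] Euc n) : Matrix (Fin n) (Fin n) ℝ :=
  Matrix.of fun i j => T (EuclideanSpace.single j 1) i

lemma fderivMat_eq {n : ℕ} (f : Euc n → Euc n) (x : Euc n) :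
    fderivMat f x = clmMat (fderiv ℝ f x) := rfl

lemma frob_eq_sum {n : ℕ} (A B : Matrix (Fin n) (Fin n) ℝ) :
    frob A B = ∑ i, ∑ j, A i j * B i j := by
  simp [frob, Matrix.trace, Matrix.mul_apply]

lemma abs_clmMat_le {n : ℕ} (T : Euc n →L[ℝ] Euc n) (i j : Fin n) : |clmMat T i j| ≤ ‖T‖ := by
  have h1 : ‖T (EuclideanSpace.single j 1) i‖ ≤ ‖T (EuclideanSpace.single j 1)‖ :=
    PiLp.norm_apply_le _ i
  have h2 := T.le_opNorm (EuclideanSpace.single j 1)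
  have h3 : ‖(EuclideanSpace.single j 1 : Euc n)‖ = 1 := by simp
  rw [h3, mul_one] at h2
  exact h1.trans h2

lemma clm_apply_eq_sum {n : ℕ} (T : Euc n →L[ℝ] Euc n) (v : Euc n) (i : Fin n) :
    T v i = ∑ j, clmMat T i j * v j := by
  have hv : v = ∑ j, v j • (EuclideanSpace.single j 1 : Euc n) := by
    ext k
    simp [Finset.sum_apply, Pi.single_apply]
  conv_lhs => rw [hv]
  simp only [map_sum, map_smul]
  simp [clmMat, mul_comm]

lemma inner_clm_eq_sum {n : ℕ} (T : Euc n →L[ℝ] Euc n) (v : Euc n) :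
    ⟪T v, v⟫ = ∑ i, ∑ j, clmMat T i j * (v i * v j) := by
  rw [PiLp.inner_apply]
  refine Finset.sum_congr rfl fun i _ => ?_
  rw [clm_apply_eq_sum]
  simp only [RCLike.inner_apply, conj_trivial]
  rw [Finset.mul_sum]
  refine Finset.sum_congr rfl fun j _ => ?_
  ring

open scoped MatrixOrder Matrix.Norms.L2Operator in
lemma frob_nonneg {n : ℕ} (T : Euc n →L[ℝ] Euc n) (hT : ∀ v, 0 ≤ ⟪T v, v⟫)
    {D : Matrix (Fin n) (Fin n) ℝ} (hD : D.PosSemidef) : 0 ≤ frob (clmMat T) D := by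
  obtain ⟨B, rfl⟩ := CStarAlgebra.nonneg_iff_eq_star_mul_self.mp hD.nonneg
  rw [frob_eq_sum]
  have h : ∑ i, ∑ j, clmMat T i j * (star B * B) i j =
      ∑ k, ⟪T (WithLp.toLp 2 (B k)), WithLp.toLp 2 (B k)⟫ := by
    simp only [inner_clm_eq_sum, Matrix.mul_apply, Matrix.star_apply, star_trivial, Finset.mul_sum]
    rw [Finset.sum_comm' (t' := Finset.univ) (s' := fun _ => Finset.univ) (by simp)]
    conv_rhs => rw [Finset.sum_comm]
    rw [Finset.sum_comm]
    refine Finset.sum_congr rfl fun i _ => ?_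
    rw [Finset.sum_comm]
  rw [h]
  exact Finset.sum_nonneg fun k _ => hT _

lemma PosSemidef.abs_entry_le {n : ℕ} {D : Matrix (Fin n) (Fin n) ℝ} (hD : D.PosSemidef)
    (i j : Fin n) : |D i j| ≤ D.trace := by
  have hdiag : ∀ k, 0 ≤ D k k := fun k => hD.diag_nonneg
  have htr : ∀ k, D k k ≤ D.trace := fun k =>
    Finset.single_le_sum (f := fun k => D k k) (fun k _ => hdiag k) (Finset.mem_univ k)
  have hs : D j i = D i j := by simpa using hD.1.apply i j
  have h1 := hD.dotProduct_mulVec_nonneg (Pi.single i 1 + Pi.single j 1)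
  have h2 := hD.dotProduct_mulVec_nonneg (Pi.single i 1 - Pi.single j 1)
  simp [Matrix.mulVec_add, Matrix.mulVec_sub, add_dotProduct, sub_dotProduct] at h1 h2
  have := htr i
  have := htr j
  rw [abs_le]; constructor <;> linarith

lemma MatMeas.ae_entry_le {n : ℕ} (M : MatMeas n n) (hM : ∀ᵐ x ∂M.var, (M.density x).PosSemidef) :
    ∀ᵐ x ∂M.var, ∀ i j, |M.density x i j| ≤ 1 := by
  filter_upwards [hM, M.norm_density] with x hx h1 i j
  rw [matAbs_of_posSemidef hx] at h1
  exact h1 ▸ PosSemidef.abs_entry_le hx i j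

lemma abs_frob_le {n : ℕ} (T : Euc n →L[ℝ] Euc n) {D : Matrix (Fin n) (Fin n) ℝ}
    (hD : ∀ i j, |D i j| ≤ 1) : |frob (clmMat T) D| ≤ n * n * ‖T‖ := by
  rw [frob_eq_sum]
  calc |∑ i, ∑ j, clmMat T i j * D i j| ≤ ∑ i : Fin n, ∑ j : Fin n, ‖T‖ := by
        refine (Finset.abs_sum_le_sum_abs _ _).trans (Finset.sum_le_sum fun i _ => ?_)
        refine (Finset.abs_sum_le_sum_abs _ _).trans (Finset.sum_le_sum fun j _ => ?_)
        rw [abs_mul]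
        calc _ ≤ ‖T‖ * 1 := mul_le_mul (abs_clmMat_le T i j) (hD i j) (abs_nonneg _) (norm_nonneg _)
          _ = _ := mul_one _
    _ = _ := by simp [mul_assoc]

lemma measurable_frob {n : ℕ} (M : MatMeas n n) {G : Euc n → (Euc n →L[ℝ] Euc n)}
    (hG : Continuous G) : Measurable fun x => frob (clmMat (G x)) (M.density x) := by
  simp only [frob_eq_sum]
  refine Finset.measurable_sum _ fun i _ => Finset.measurable_sum _ fun j _ => ?_
  refine Measurable.mul ?_ (M.measurable_density i j)
  have : Continuous fun x => clmMat (G x) i j := by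
    simp only [clmMat, Matrix.of_apply]
    have h1 : Continuous fun x => G x (EuclideanSpace.single j 1) := hG.clm_apply continuous_const
    fun_prop
  exact this.measurable

/-- Cutoff argument: the divergence identity extends from compactly supported fields to
fields with bounded derivative. -/
lemma pair_eq_of_compact {n : ℕ} (M : MatMeas n n) (hM : ∀ᵐ x ∂M.var, (M.density x).PosSemidef)
    (μ : VecMeas n n)
    (hdiv : ∀ f : Euc n → Euc n, ContDiff ℝ 1 f → HasCompactSupport f →
      μ.pair f = M.pair (fderivMat f))
    {u : Euc n → Euc n} (hu : C1b u) (hint : Integrable (fun x => ⟪u x, μ.density x⟫) μ.var) :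
    μ.pair u = M.pair (fderivMat u) := by
  have := M.finite
  have := μ.finite
  let χ : ContDiffBump (0 : Euc n) := ⟨1, 2, one_pos, one_lt_two⟩
  have hχ : ContDiff ℝ 1 (χ : Euc n → ℝ) := χ.contDiff
  have hχd : Differentiable ℝ (χ : Euc n → ℝ) := hχ.differentiable one_ne_zero
  obtain ⟨B, hB⟩ : ∃ B, ∀ x, ‖fderiv ℝ (χ : Euc n → ℝ) x‖ ≤ B :=
    (χ.hasCompactSupport.fderiv ℝ).exists_bound_of_continuous (hχ.continuous_fderiv one_ne_zero)
  have hB0 : 0 ≤ B := (norm_nonneg _).trans (hB 0)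
  obtain ⟨C, hC0, hC⟩ := hu.growth
  obtain ⟨huc, A, hA⟩ := hu
  have hud : Differentiable ℝ u := huc.differentiable one_ne_zero
  let r : ℕ → ℝ := fun k => (k : ℝ) + 1
  have hr : ∀ k, 1 ≤ r k := fun k => by simp [r]
  have hr0 : ∀ k, 0 < r k := fun k => one_pos.trans_le (hr k)
  let f : ℕ → Euc n → Euc n := fun k x => χ ((r k)⁻¹ • x) • u x
  have hsc : ∀ k, ContDiff ℝ 1 (fun x : Euc n => (r k)⁻¹ • x) := fun k => contDiff_id.const_smul _
  have hfc : ∀ k, ContDiff ℝ 1 (f k) := fun k => (hχ.comp (hsc k)).smul huc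
  have hzero : ∀ k x, 2 * r k ≤ ‖x‖ → χ ((r k)⁻¹ • x) = 0 := by
    intro k x hx
    apply χ.zero_of_le_dist
    show (2:ℝ) ≤ _
    rw [dist_zero_right, norm_smul, norm_inv, Real.norm_of_nonneg (hr0 k).le, inv_mul_eq_div,
      le_div_iff₀ (hr0 k)]
    exact hx
  have hone : ∀ k x, ‖x‖ ≤ r k → χ ((r k)⁻¹ • x) = 1 := by
    intro k x hx
    apply χ.one_of_mem_closedBall
    show _ ∈ Metric.closedBall (0 : Euc n) 1
    rw [mem_closedBall_zero_iff, norm_smul, norm_inv, Real.norm_of_nonneg (hr0 k).le,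
      inv_mul_eq_div, div_le_one (hr0 k)]
    exact hx
  have hfs : ∀ k, HasCompactSupport (f k) := by
    intro k
    refine HasCompactSupport.intro (isCompact_closedBall (0 : Euc n) (2 * r k)) fun x hx => ?_
    rw [mem_closedBall_zero_iff, not_le] at hx
    simp [f, hzero k x hx.le]
  have hlim : ∀ x : Euc n, ∀ᶠ k in atTop, ‖x‖ < r k := by
    intro x
    have : Tendsto r atTop atTop := tendsto_atTop_add_const_right _ _ tendsto_natCast_atTop_atTop
    exact this.eventually_gt_atTop _
  have hfeq : ∀ x, ∀ᶠ k in atTop, f k x = u x := by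
    intro x
    filter_upwards [hlim x] with k hk
    simp [f, hone k x hk.le]
  have hdeq : ∀ x, ∀ᶠ k in atTop, fderiv ℝ (f k) x = fderiv ℝ u x := by
    intro x
    filter_upwards [hlim x] with k hk
    apply Filter.EventuallyEq.fderiv_eq
    have : ∀ᶠ y : Euc n in 𝓝 x, ‖y‖ < r k := continuous_norm.continuousAt.eventually_lt_const hk
    filter_upwards [this] with y hy
    simp [f, hone k y hy.le]
  have hbound : ∀ k x, ‖fderiv ℝ (f k) x‖ ≤ A + 3 * B * C := by
    intro k x
    have hA0 : 0 ≤ A := (norm_nonneg _).trans (hA 0)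
    rcases lt_or_ge (2 * r k) ‖x‖ with hx | hx
    · have : f k =ᶠ[𝓝 x] fun _ => 0 := by
        have : ∀ᶠ y : Euc n in 𝓝 x, 2 * r k < ‖y‖ := continuous_norm.continuousAt.eventually_const_lt hx
        filter_upwards [this] with y hy
        simp [f, hzero k y hy.le]
      rw [this.fderiv_eq]
      simp only [fderiv_fun_const, Pi.zero_apply, norm_zero]
      positivity
    · have e1 : fderiv ℝ (f k) x = χ ((r k)⁻¹ • x) • fderiv ℝ u x +
          ((r k)⁻¹ • fderiv ℝ (χ : Euc n → ℝ) ((r k)⁻¹ • x)).smulRight (u x) := by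
        have := fderiv_fun_smul (𝕜 := ℝ) (c := fun x : Euc n => χ ((r k)⁻¹ • x)) (f := u) (x := x)
          ((hχ.comp (hsc k)).differentiable one_ne_zero x) (hud x)
        rw [fderiv_comp_smul] at this
        exact this
      rw [e1]
      have h1 : ‖χ ((r k)⁻¹ • x) • fderiv ℝ u x‖ ≤ A := by
        rw [norm_smul, Real.norm_of_nonneg χ.nonneg]
        calc _ ≤ 1 * A := mul_le_mul χ.le_one (hA x) (norm_nonneg _) zero_le_one
          _ = A := one_mul _
      have h2 : ‖((r k)⁻¹ • fderiv ℝ (χ : Euc n → ℝ) ((r k)⁻¹ • x)).smulRight (u x)‖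
          ≤ 3 * B * C := by
        rw [ContinuousLinearMap.norm_smulRight_apply, norm_smul, norm_inv,
          Real.norm_of_nonneg (hr0 k).le]
        have h3 : ‖u x‖ ≤ C * (3 * r k) := by
          refine (hC x).trans (mul_le_mul_of_nonneg_left ?_ hC0)
          have := hr k
          linarith
        calc (r k)⁻¹ * ‖fderiv ℝ (χ : Euc n → ℝ) ((r k)⁻¹ • x)‖ * ‖u x‖
            ≤ (r k)⁻¹ * B * (C * (3 * r k)) := by
              have := hr0 k
              have := hB ((r k)⁻¹ • x)
              gcongr
          _ = 3 * B * C := by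
              have := (hr0 k).ne'
              field_simp
      exact (norm_add_le _ _).trans (add_le_add h1 h2)
  have t1 : Tendsto (fun k => μ.pair (f k)) atTop (𝓝 (μ.pair u)) := by
    refine tendsto_integral_of_dominated_convergence (fun x => ‖⟪u x, μ.density x⟫‖) ?_ hint.norm
      ?_ ?_
    · intro k
      exact ((hfc k).continuous.measurable.inner μ.measurable_density).aestronglyMeasurable
    · intro k
      refine Eventually.of_forall fun x => ?_
      simp only [f]
      rw [real_inner_smul_left, norm_mul, Real.norm_of_nonneg χ.nonneg]
      exact mul_le_of_le_one_left (norm_nonneg _) χ.le_one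
    · refine Eventually.of_forall fun x => ?_
      refine tendsto_const_nhds.congr' ?_
      filter_upwards [hfeq x] with k hk
      rw [hk]
  have t2 : Tendsto (fun k => M.pair (fderivMat (f k))) atTop (𝓝 (M.pair (fderivMat u))) := by
    refine tendsto_integral_of_dominated_convergence (fun _ => n * n * (A + 3 * B * C)) ?_
      (integrable_const _) ?_ ?_
    · intro k
      exact (measurable_frob M ((hfc k).continuous_fderiv one_ne_zero)).aestronglyMeasurable
    · intro k
      filter_upwards [M.ae_entry_le hM] with x hx
      refine (abs_frob_le (fderiv ℝ (f k) x) hx).trans ?_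
      exact mul_le_mul_of_nonneg_left (hbound k x) (by positivity)
    · refine Eventually.of_forall fun x => ?_
      refine tendsto_const_nhds.congr' ?_
      filter_upwards [hdeq x] with k hk
      rw [fderivMat_eq, fderivMat_eq, hk]
  refine tendsto_nhds_unique t1 (t2.congr fun k => ?_)
  exact (hdiv (f k) (hfc k) (hfs k)).symm

/-- The bounded continuous operator field `x ↦ φ x • T`. -/
def ccSmul {n : ℕ} (φ : C_c(Euc n, ℝ)) (T : Euc n →L[ℝ] Euc n) :
    Euc n →ᵇ (Euc n →L[ℝ] Euc n) :=
  BoundedContinuousFunction.ofNormedAddCommGroup (fun x => φ x • T)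
    (φ.continuous.smul continuous_const)
    (Classical.choose (φ.hasCompactSupport.exists_bound_of_continuous φ.continuous) * ‖T‖)
    (fun x => by
      rw [norm_smul]
      exact mul_le_mul_of_nonneg_right (Classical.choose_spec
        (φ.hasCompactSupport.exists_bound_of_continuous φ.continuous) x) (norm_nonneg _))

@[simp] lemma ccSmul_apply {n : ℕ} (φ : C_c(Euc n, ℝ)) (T : Euc n →L[ℝ] Euc n) (x : Euc n) :
    ccSmul φ T x = φ x • T := rfl

/-- The scalar functional `φ ↦ g (φ • T)`. -/
def scalarFun {n : ℕ} (g : (Euc n →ᵇ (Euc n →L[ℝ] Euc n)) →ₗ[ℝ] ℝ) (T : Euc n →L[ℝ] Euc n) :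
    C_c(Euc n, ℝ) →ₗ[ℝ] ℝ where
  toFun φ := g (ccSmul φ T)
  map_add' φ ψ := by
    rw [← map_add]; congr 1; ext1 x; exact add_smul (φ x) (ψ x) T
  map_smul' c φ := by
    rw [RingHom.id_apply, ← map_smul]; congr 1; ext1 x; simp [mul_smul]

lemma exists_scalar_measure {n : ℕ} (g : (Euc n →ᵇ (Euc n →L[ℝ] Euc n)) →ₗ[ℝ] ℝ)
    (hg : ∀ G : Euc n →ᵇ (Euc n →L[ℝ] Euc n), (∀ x v, 0 ≤ ⟪G x v, v⟫) → 0 ≤ g G)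
    (T : Euc n →L[ℝ] Euc n) (hT : ∀ v, 0 ≤ ⟪T v, v⟫) :
    ∃ ν : Measure (Euc n), IsFiniteMeasure ν ∧
      ∀ φ : C_c(Euc n, ℝ), ∫ x, φ x ∂ν = g (ccSmul φ T) := by
  let Λ : C_c(Euc n, ℝ) →ₚ[ℝ] ℝ := PositiveLinearMap.mk₀ (scalarFun g T) (by
    intro φ hφ
    refine hg _ fun x v => ?_
    rw [ccSmul_apply, _root_.smul_apply, real_inner_smul_left]
    exact mul_nonneg (hφ x) (hT v))
  have hΛ : ∀ φ, Λ φ = g (ccSmul φ T) := fun φ => rfl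
  refine ⟨RealRMK.rieszMeasure Λ, ⟨?_⟩, fun φ => RealRMK.integral_rieszMeasure Λ φ⟩
  have hball : ∀ k : ℕ, RealRMK.rieszMeasure Λ (Metric.closedBall 0 (k : ℝ)) ≤
      ENNReal.ofReal (g (BoundedContinuousFunction.const _ T)) := by
    intro k
    let χ : ContDiffBump (0 : Euc n) := ⟨k + 1, k + 2, by positivity, by linarith⟩
    let φ : C_c(Euc n, ℝ) := ⟨⟨χ, χ.continuous⟩, χ.hasCompactSupport⟩
    have hφ : ∀ x, φ x = χ x := fun x => rfl
    refine (RealRMK.rieszMeasure_le_of_eq_one Λ (f := φ) (fun x => χ.nonneg)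
      (isCompact_closedBall _ _) (fun x hx => ?_)).trans ?_
    · apply χ.one_of_mem_closedBall
      exact Metric.closedBall_subset_closedBall (by show (k:ℝ) ≤ k + 1; linarith) hx
    · refine ENNReal.ofReal_le_ofReal ?_
      rw [hΛ, ← sub_nonneg, ← map_sub]
      refine hg _ fun x v => ?_
      have e : (BoundedContinuousFunction.const (Euc n) T - ccSmul φ T) x v = (1 - χ x) • T v := by
        rw [sub_smul, one_smul]; rfl
      rw [e, real_inner_smul_left]
      exact mul_nonneg (sub_nonneg.2 χ.le_one) (hT v)
  have hmono : Monotone fun k : ℕ => Metric.closedBall (0 : Euc n) (k : ℝ) := fun a b h =>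
    Metric.closedBall_subset_closedBall (by exact_mod_cast h)
  have hU : (⋃ k : ℕ, Metric.closedBall (0 : Euc n) (k : ℝ)) = Set.univ :=
    Metric.iUnion_closedBall_nat 0
  rw [← hU, hmono.measure_iUnion]
  exact (iSup_le hball).trans_lt ENNReal.ofReal_lt_top

lemma ccSmul_add {n : ℕ} (φ : C_c(Euc n, ℝ)) (S T : Euc n →L[ℝ] Euc n) :
    ccSmul φ (S + T) = ccSmul φ S + ccSmul φ T := by
  ext1 x; simp

lemma ccSmul_smul {n : ℕ} (φ : C_c(Euc n, ℝ)) (c : ℝ) (T : Euc n →L[ℝ] Euc n) :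
    ccSmul φ (c • T) = c • ccSmul φ T := by
  ext1 x; exact smul_comm (φ x) c T

lemma cc_integrable {n : ℕ} (φ : C_c(Euc n, ℝ)) (ν : Measure (Euc n)) [IsFiniteMeasure ν] :
    Integrable (fun x => φ x) ν :=
  φ.continuous.integrable_of_hasCompactSupport φ.hasCompactSupport

lemma cc_mul_integrable {n : ℕ} (φ : C_c(Euc n, ℝ)) {ν : Measure (Euc n)} {k : Euc n → ℝ}
    (hk : Integrable k ν) : Integrable (fun x => φ x * k x) ν := by
  obtain ⟨C, hC⟩ := φ.hasCompactSupport.exists_bound_of_continuous φ.continuous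
  exact hk.bdd_mul φ.continuous.aestronglyMeasurable (Eventually.of_forall hC)

lemma inner_norm_add {n : ℕ} (T : Euc n →L[ℝ] Euc n) (v : Euc n) :
    |⟪T v, v⟫| ≤ ‖T‖ * ⟪v, v⟫ := by
  refine (abs_real_inner_le_norm _ _).trans ?_
  rw [real_inner_self_eq_norm_sq]
  have := T.le_opNorm v
  nlinarith [norm_nonneg v]

/-- Density of the functional of a positive operator relative to the trace measure. -/
lemma exists_density_pos {n : ℕ} (g : (Euc n →ᵇ (Euc n →L[ℝ] Euc n)) →ₗ[ℝ] ℝ)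
    (hg : ∀ G : Euc n →ᵇ (Euc n →L[ℝ] Euc n), (∀ x v, 0 ≤ ⟪G x v, v⟫) → 0 ≤ g G)
    (ν : Measure (Euc n)) [IsFiniteMeasure ν]
    (hν : ∀ φ : C_c(Euc n, ℝ), ∫ x, φ x ∂ν = g (ccSmul φ (ContinuousLinearMap.id ℝ (Euc n))))
    (T : Euc n →L[ℝ] Euc n) (hT : ∀ v, 0 ≤ ⟪T v, v⟫) :
    ∃ k : Euc n → ℝ, Measurable k ∧ Integrable k ν ∧ (∀ x, 0 ≤ k x) ∧
      ∀ φ : C_c(Euc n, ℝ), ∫ x, φ x * k x ∂ν = g (ccSmul φ T) := by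
  obtain ⟨ν₁, h1, hν₁⟩ := exists_scalar_measure g hg T hT
  let S : Euc n →L[ℝ] Euc n := ‖T‖ • ContinuousLinearMap.id ℝ (Euc n) + (-1 : ℝ) • T
  obtain ⟨ν₂, h2, hν₂⟩ := exists_scalar_measure g hg S (by
    intro v
    have := le_of_abs_le (inner_norm_add T v)
    have e : S v = ‖T‖ • v + (-1 : ℝ) • T v := rfl
    rw [e, inner_add_left, real_inner_smul_left, real_inner_smul_left]
    linarith)
  have hsum : ν₁ + ν₂ = ‖T‖₊ • ν := by
    apply Measure.ext_of_integral_eq_on_compactlySupported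
    intro φ
    rw [integral_add_measure (cc_integrable φ ν₁) (cc_integrable φ ν₂), hν₁, hν₂,
      integral_smul_nnreal_measure, hν]
    simp only [S, ccSmul_add, ccSmul_smul, map_add, map_smul]
    simp [NNReal.smul_def]
  have hac : ν₁ ≪ ν := by
    intro A hA
    have h3 : (ν₁ + ν₂) A = 0 := by rw [hsum]; simp [hA]
    rw [Measure.add_apply] at h3
    exact (add_eq_zero.1 h3).1
  refine ⟨fun x => (ν₁.rnDeriv ν x).toReal, (Measure.measurable_rnDeriv _ _).ennreal_toReal,
    Measure.integrable_toReal_rnDeriv, fun x => ENNReal.toReal_nonneg, fun φ => ?_⟩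
  have h4 : ν₁.HaveLebesgueDecomposition ν :=
    Measure.haveLebesgueDecomposition_of_sigmaFinite ν₁ ν
  have h5 : ∫ x, (ν₁.rnDeriv ν x).toReal • φ x ∂ν = ∫ x, φ x ∂ν₁ := integral_rnDeriv_smul hac
  rw [← hν₁, ← h5]
  refine integral_congr_ae (Eventually.of_forall fun x => ?_)
  exact mul_comm _ _

lemma exists_density {n : ℕ} (g : (Euc n →ᵇ (Euc n →L[ℝ] Euc n)) →ₗ[ℝ] ℝ)
    (hg : ∀ G : Euc n →ᵇ (Euc n →L[ℝ] Euc n), (∀ x v, 0 ≤ ⟪G x v, v⟫) → 0 ≤ g G)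
    (ν : Measure (Euc n)) [IsFiniteMeasure ν]
    (hν : ∀ φ : C_c(Euc n, ℝ), ∫ x, φ x ∂ν = g (ccSmul φ (ContinuousLinearMap.id ℝ (Euc n))))
    (T : Euc n →L[ℝ] Euc n) :
    ∃ k : Euc n → ℝ, Measurable k ∧ Integrable k ν ∧
      ∀ φ : C_c(Euc n, ℝ), ∫ x, φ x * k x ∂ν = g (ccSmul φ T) := by
  obtain ⟨k, hk1, hk2, -, hk⟩ := exists_density_pos g hg ν hν
    (‖T‖ • ContinuousLinearMap.id ℝ (Euc n) + T) (by
      intro v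
      have := neg_le_of_abs_le (inner_norm_add T v)
      have e : (‖T‖ • ContinuousLinearMap.id ℝ (Euc n) + T) v = ‖T‖ • v + T v := rfl
      rw [e, inner_add_left, real_inner_smul_left]
      linarith)
  refine ⟨fun x => k x - ‖T‖, hk1.sub_const _, hk2.sub (integrable_const _), fun φ => ?_⟩
  simp only [mul_sub]
  rw [integral_sub (cc_mul_integrable φ hk2) ((cc_integrable φ ν).mul_const _), hk,
    integral_mul_const, hν, ccSmul_add, ccSmul_smul, map_add, map_smul, smul_eq_mul]
  ring

lemma density_unique {n : ℕ} {ν : Measure (Euc n)} [IsFiniteMeasure ν] {k l : Euc n → ℝ}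
    (hk : Integrable k ν) (hl : Integrable l ν)
    (h : ∀ φ : C_c(Euc n, ℝ), ∫ x, φ x * k x ∂ν = ∫ x, φ x * l x ∂ν) : ∀ᵐ x ∂ν, k x = l x := by
  have := ae_eq_zero_of_integral_contDiff_smul_eq_zero (μ := ν) (f := fun x => k x - l x)
    (hk.sub hl).locallyIntegrable (fun φ hφ hφ' => by
      let ψ : C_c(Euc n, ℝ) := ⟨⟨φ, hφ.continuous⟩, hφ'⟩
      have e : ∀ x, φ x • (k x - l x) = ψ x * k x - ψ x * l x := fun x => mul_sub _ _ _
      simp only [e]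
      rw [integral_sub (cc_mul_integrable ψ hk) (cc_mul_integrable ψ hl), h, sub_self])
  filter_upwards [this] with x hx
  linarith

/-- The elementary operator `v ↦ v j • e i`. -/
def elemOp {n : ℕ} (i j : Fin n) : Euc n →L[ℝ] Euc n :=
  (EuclideanSpace.proj j : Euc n →L[ℝ] ℝ).smulRight (EuclideanSpace.single i 1)

lemma elemOp_apply {n : ℕ} (i j : Fin n) (v : Euc n) :
    elemOp i j v = v j • (EuclideanSpace.single i 1 : Euc n) := rfl

lemma inner_elemOp {n : ℕ} (i j : Fin n) (v : Euc n) : ⟪elemOp i j v, v⟫ = v j * v i := by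
  rw [elemOp_apply, real_inner_smul_left]
  simp [EuclideanSpace.inner_single_left]

lemma clm_eq_sum_elemOp {n : ℕ} (T : Euc n →L[ℝ] Euc n) :
    T = ∑ i, ∑ j, clmMat T i j • elemOp i j := by
  ext v k
  rw [clm_apply_eq_sum]
  have e : (∑ i, ∑ j, clmMat T i j • elemOp i j) v =
      ∑ i, ∑ j, (clmMat T i j * v j) • (EuclideanSpace.single i 1 : Euc n) := by
    simp only [ContinuousLinearMap.sum_apply, _root_.smul_apply, elemOp_apply, smul_smul]
  rw [e]
  simp [Pi.single_apply]

lemma clmMat_id {n : ℕ} : clmMat (ContinuousLinearMap.id ℝ (Euc n)) = 1 := by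
  ext i j
  simp [clmMat, Pi.single_apply, Matrix.one_apply]

lemma frob_one {n : ℕ} (D : Matrix (Fin n) (Fin n) ℝ) : frob 1 D = D.trace := by
  simp [frob, Matrix.trace]

lemma ccSmul_sum {n : ℕ} {ι : Type*} (s : Finset ι) (φ : C_c(Euc n, ℝ))
    (T : ι → (Euc n →L[ℝ] Euc n)) : ccSmul φ (∑ i ∈ s, T i) = ∑ i ∈ s, ccSmul φ (T i) := by
  ext1 x
  rw [BoundedContinuousFunction.sum_apply]
  simp only [ccSmul_apply]
  exact Finset.smul_sum

/-- Riesz representation of positive functionals on bounded operator fields. -/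
lemma exists_matMeas {n : ℕ} (g : (Euc n →ᵇ (Euc n →L[ℝ] Euc n)) →ₗ[ℝ] ℝ)
    (hg : ∀ G : Euc n →ᵇ (Euc n →L[ℝ] Euc n), (∀ x v, 0 ≤ ⟪G x v, v⟫) → 0 ≤ g G) :
    ∃ M : MatMeas n n, (∀ᵐ x ∂M.var, (M.density x).PosSemidef) ∧
      ∀ G : Euc n →ᵇ (Euc n →L[ℝ] Euc n), HasCompactSupport G →
        g G = M.pair (fun x => clmMat (G x)) := by
  obtain ⟨ν, hfin, hν⟩ := exists_scalar_measure g hg (ContinuousLinearMap.id ℝ (Euc n))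
    (fun v => real_inner_self_nonneg)
  have hK := fun i j : Fin n => exists_density g hg ν hν (elemOp i j)
  choose K hKm hKi hK using hK
  let D : Euc n → Matrix (Fin n) (Fin n) ℝ := fun x => Matrix.of fun i j => K i j x
  have hDi : ∀ A : Matrix (Fin n) (Fin n) ℝ, Integrable (fun x => frob A (D x)) ν := by
    intro A
    simp only [frob_eq_sum]
    exact integrable_finsetSum _ fun i _ => integrable_finsetSum _ fun j _ =>
      (hKi i j).const_mul _
  have H : ∀ (T : Euc n →L[ℝ] Euc n) (φ : C_c(Euc n, ℝ)),
      ∫ x, φ x * frob (clmMat T) (D x) ∂ν = g (ccSmul φ T) := by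
    intro T φ
    have hi : ∀ i j, Integrable (fun x => clmMat T i j * (φ x * K i j x)) ν := fun i j =>
      (cc_mul_integrable φ (hKi i j)).const_mul _
    have e : ∀ x, φ x * frob (clmMat T) (D x) = ∑ i, ∑ j, clmMat T i j * (φ x * K i j x) := by
      intro x
      rw [frob_eq_sum, Finset.mul_sum]
      refine Finset.sum_congr rfl fun i _ => ?_
      rw [Finset.mul_sum]
      refine Finset.sum_congr rfl fun j _ => ?_
      simp only [D, Matrix.of_apply]
      ring
    simp only [e]
    rw [integral_finsetSum _ fun i _ => integrable_finsetSum _ fun j _ => hi i j]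
    conv_rhs => rw [clm_eq_sum_elemOp T]
    rw [ccSmul_sum, map_sum]
    refine Finset.sum_congr rfl fun i _ => ?_
    rw [integral_finsetSum _ fun j _ => hi i j, ccSmul_sum, map_sum]
    refine Finset.sum_congr rfl fun j _ => ?_
    rw [integral_const_mul, hK, ccSmul_smul, map_smul, smul_eq_mul]
  have htr : ∀ᵐ x ∂ν, (D x).trace = 1 := by
    refine density_unique (k := fun x => (D x).trace) (l := fun _ => 1) ?_ (integrable_const _) ?_
    · have := hDi 1
      simpa only [frob_one] using this
    · intro φ
      have := H (ContinuousLinearMap.id ℝ (Euc n)) φ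
      rw [clmMat_id] at this
      simp only [frob_one] at this
      rw [this, ← hν]
      simp
  have hsymle : ∀ i j (φ : C_c(Euc n, ℝ)), g (ccSmul φ (elemOp i j)) ≤
      g (ccSmul φ (elemOp j i)) := by
    intro i j φ
    rw [← sub_nonneg, ← map_sub]
    refine hg _ fun x v => ?_
    have e : (ccSmul φ (elemOp j i) - ccSmul φ (elemOp i j)) x v =
      φ x • elemOp j i v - φ x • elemOp i j v := rfl
    rw [e, inner_sub_left, real_inner_smul_left, real_inner_smul_left, inner_elemOp, inner_elemOp]
    apply le_of_eq
    ring
  have hsym : ∀ᵐ x ∂ν, ∀ i j, K i j x = K j i x := by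
    rw [ae_all_iff]; intro i
    rw [ae_all_iff]; intro j
    refine density_unique (hKi i j) (hKi j i) fun φ => ?_
    rw [hK, hK]
    exact le_antisymm (hsymle i j φ) (hsymle j i φ)
  have hq : ∀ v : Euc n, ∀ᵐ x ∂ν, 0 ≤ ∑ i, ∑ j, (v i * v j) * D x i j := by
    intro v
    let T : Euc n →L[ℝ] Euc n := (innerSL ℝ v).smulRight v
    have hTa : ∀ w, T w = ⟪v, w⟫ • v := fun w => rfl
    have hTm : ∀ i j, clmMat T i j = v i * v j := by
      intro i j
      have : clmMat T i j = (T (EuclideanSpace.single j 1)) i := rfl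
      rw [this, hTa]
      simp [EuclideanSpace.inner_single_right, mul_comm]
    obtain ⟨k, hk1, hk2, hk3, hk⟩ := exists_density_pos g hg ν hν T (by
      intro w
      rw [hTa, real_inner_smul_left]
      exact mul_self_nonneg _)
    have := density_unique (hDi (clmMat T)) hk2 (fun φ => by rw [H, hk])
    filter_upwards [this] with x hx
    rw [frob_eq_sum] at hx
    simp only [hTm] at hx
    rw [hx]
    exact hk3 x
  have hpsd : ∀ᵐ x ∂ν, (D x).PosSemidef := by
    have hq' : ∀ᵐ x ∂ν, ∀ m : ℕ, 0 ≤ ∑ i, ∑ j,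
        (TopologicalSpace.denseSeq (Euc n) m i * TopologicalSpace.denseSeq (Euc n) m j) * D x i j :=
      ae_all_iff.2 fun m => hq _
    filter_upwards [hsym, hq'] with x hs hx
    have hall : ∀ v : Euc n, 0 ≤ ∑ i, ∑ j, (v i * v j) * D x i j := by
      have hc : IsClosed {v : Euc n | 0 ≤ ∑ i, ∑ j, (v i * v j) * D x i j} :=
        isClosed_le continuous_const (by fun_prop)
      have hd := TopologicalSpace.denseRange_denseSeq (Euc n)
      intro v
      have : closure (Set.range (TopologicalSpace.denseSeq (Euc n))) ⊆
          {v : Euc n | 0 ≤ ∑ i, ∑ j, (v i * v j) * D x i j} :=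
        closure_minimal (by rintro _ ⟨m, rfl⟩; exact hx m) hc
      exact this (hd v)
    refine Matrix.PosSemidef.of_dotProduct_mulVec_nonneg ?_ fun v => ?_
    · ext i j
      simpa [D] using hs j i
    · have := hall (WithLp.toLp 2 v)
      refine this.trans_eq ?_
      simp only [dotProduct, Matrix.mulVec, star_trivial, Pi.star_apply, Finset.mul_sum]
      refine Finset.sum_congr rfl fun i _ => Finset.sum_congr rfl fun j _ => ?_
      ring
  refine ⟨⟨ν, D, hfin, hKm, ?_⟩, hpsd, ?_⟩
  · filter_upwards [hpsd, htr] with x h1 h2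
    rw [matAbs_of_posSemidef h1, h2]
  · intro G hG
    have hGc : ∀ i j, Continuous fun x => clmMat (G x) i j := by
      intro i j
      simp only [clmMat, Matrix.of_apply]
      have h1 : Continuous fun x => G x (EuclideanSpace.single j 1) :=
        G.continuous.clm_apply continuous_const
      fun_prop
    have hGs : ∀ i j, HasCompactSupport fun x => clmMat (G x) i j := by
      intro i j
      exact hG.comp_left (g := fun T : Euc n →L[ℝ] Euc n => clmMat T i j) (by simp [clmMat])
    let φ : Fin n → Fin n → C_c(Euc n, ℝ) := fun i j =>
      ⟨⟨fun x => clmMat (G x) i j, hGc i j⟩, hGs i j⟩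
    have hGe : G = ∑ i, ∑ j, ccSmul (φ i j) (elemOp i j) := by
      ext1 x
      rw [BoundedContinuousFunction.sum_apply]
      simp only [BoundedContinuousFunction.sum_apply, ccSmul_apply]
      exact clm_eq_sum_elemOp (G x)
    conv_lhs => rw [hGe]
    have hi : ∀ i j, Integrable (fun x => clmMat (G x) i j * D x i j) ν := fun i j =>
      cc_mul_integrable (φ i j) (hKi i j)
    simp only [MatMeas.pair, frob_eq_sum, map_sum]
    rw [integral_finsetSum _ fun i _ => integrable_finsetSum _ fun j _ => hi i j]
    refine Finset.sum_congr rfl fun i _ => ?_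
    rw [integral_finsetSum _ fun j _ => hi i j]
    refine Finset.sum_congr rfl fun j _ => ?_
    exact (hK i j (φ i j)).symm

/-- **Theorem 5.5 (representation of the dual cone to monotone maps)**: if
μ ∈ 𝓜(ℝⁿ, ℝⁿ) has finite first moments and ∫⟨u, dμ⟩ ≥ 0 for every monotone
u ∈ C¹(ℝⁿ, ℝⁿ), then there is a measure M with values in symmetric positive
semidefinite matrices with μ = −div M and ∫ tr(dM) = ∫⟨x, dμ(x)⟩.  Conversely,
if M takes values in symmetric positive semidefinite matrices and −div M is a
finite vector-valued measure μ, then ∫⟨u, dμ⟩ ≥ 0 for every monotone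
u ∈ C¹(ℝⁿ, ℝⁿ). -/
theorem dualCone_monotone_representation {n : ℕ} :
    (∀ μ : VecMeas n n, μ.finiteFirstMoment →
      (∀ u : Euc n → Euc n, C1b u → IsMonotoneMap u → 0 ≤ μ.pair u) →
      ∃ M : MatMeas n n,
        (∀ᵐ x ∂M.var, (M.density x).PosSemidef) ∧
        IsNegDiv M μ ∧
        ∫ x, Matrix.trace (M.density x) ∂M.var = μ.pair (fun x => x)) ∧
    (∀ M : MatMeas n n, (∀ᵐ x ∂M.var, (M.density x).PosSemidef) →
      ∀ μ : VecMeas n n, IsNegDiv M μ →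
      ∀ u : Euc n → Euc n, C1b u → IsMonotoneMap u → 0 ≤ μ.pair u) := by
  constructor
  · intro μ hμ hpos
    obtain ⟨g, hg1, hg2⟩ := exists_positive_functional μ hμ hpos
    obtain ⟨M, hM, hMG⟩ := exists_matMeas g hg2
    have hdiv : ∀ f : Euc n → Euc n, ContDiff ℝ 1 f → HasCompactSupport f →
        μ.pair f = M.pair (fderivMat f) := by
      intro f hf hfs
      have hc : Continuous (fderiv ℝ f) := hf.continuous_fderiv one_ne_zero
      obtain ⟨C, hC⟩ := (hfs.fderiv ℝ).exists_bound_of_continuous hc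
      let G : Euc n →ᵇ (Euc n →L[ℝ] Euc n) :=
        BoundedContinuousFunction.ofNormedAddCommGroup (fderiv ℝ f) hc C hC
      rw [← hg1 f ⟨hf, C, hC⟩ G (fun x => rfl)]
      exact hMG G (hfs.fderiv ℝ)
    refine ⟨M, hM, ?_, ?_⟩
    · intro f hf
      exact pair_eq_of_compact M hM μ hdiv hf.c1b (hf.c1b.integrable μ hμ)
    · rw [pair_eq_of_compact M hM μ hdiv C1b.id' (C1b.id'.integrable μ hμ)]
      simp only [MatMeas.pair, fderivMat_eq, fderiv_fun_id, clmMat_id, frob_one]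
  · intro M hM μ hdiv u hu hmon
    by_cases hint : Integrable (fun x => ⟪u x, μ.density x⟫) μ.var
    · rw [pair_eq_of_compact M hM μ ?_ hu hint]
      · refine integral_nonneg_of_ae ?_
        filter_upwards [hM] with x hx
        exact frob_nonneg _ (fderiv_of_monotone (hu.1.differentiable one_ne_zero) hmon x) hx
      · intro f hf hfs
        refine hdiv f ⟨hf, ?_⟩
        have h0 : HasCompactSupport (fun x => ‖fderiv ℝ f x‖) := (hfs.fderiv ℝ).norm
        exact h0.is_zero_at_infty
    · rw [VecMeas.pair, integral_undef hint]
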